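/- Let G = (V, E) be a finite simple undirected graph with n = |V| vertices, let 1 ≤ T ≤ n, and set C = n − T + 1. If an enumeration v_1, …, v_n of V (each vertex loaded exactly once), processed by an initially empty cache of capacity C under the LIFO eviction policy, covers every edge of G, then the last T loaded vertices {v_{n−T+1}, …, v_n} form an independent set of size T in G. -/

import Mathlib

/-- The cache state (as a stack, most recently loaded first) after loading the
vertices of `l` in order into an initially empty cache of capacity `C` under
the LIFO eviction policy: if the cache is full, the most recently loaded
cached vertex (the head of the stack) is evicted. -/
def lifoRun {V : Type*} (C : ℕ) (l : List V) : List V :=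
  l.foldl (fun s x => if s.length < C then x :: s else x :: s.tail) []

/-- A pair of vertices `u, w` is covered by the LIFO schedule of load sequence `l`
with capacity `C` if at some moment both are in the cache simultaneously. -/
def coveredLIFO {V : Type*} (C : ℕ) (l : List V) (u w : V) : Prop :=
  ∃ i ≤ l.length, u ∈ lifoRun C (l.take i) ∧ w ∈ lifoRun C (l.take i)

theorem lifoRun_append_singleton {V : Type*} (C : ℕ) (l : List V) (x : V) :
    lifoRun C (l ++ [x]) =
      if (lifoRun C l).length < C then x :: lifoRun C l else x :: (lifoRun C l).tail := by
  rw [lifoRun, List.foldl_append]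
  rfl

/-- Under LIFO with capacity `k + 1`, the cache holds the last loaded vertex together
with the vertices among the first `k` loads that precede it. -/
theorem lifoRun_succ_append_singleton {V : Type*} (k : ℕ) (l : List V) (x : V) :
    lifoRun (k + 1) (l ++ [x]) = x :: (l.take k).reverse := by
  induction l using List.reverseRecOn generalizing x with
  | nil => simp [lifoRun]
  | append_singleton l y ih =>
    rw [lifoRun_append_singleton, ih]
    by_cases h : l.length < k
    · rw [if_pos (by simp; omega), List.take_of_length_le h.le,
        List.take_of_length_le (by simp; omega)]
      simp
    · rw [if_neg (by simp; omega), List.take_append_of_le_length (by omega)]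
      rfl

theorem mem_lifoRun_succ {V : Type*} {k : ℕ} {l : List V} {u : V}
    (h : u ∈ lifoRun (k + 1) l) : u ∈ l.take k ∨ l.getLast? = some u := by
  induction l using List.reverseRecOn with
  | nil => simp [lifoRun] at h
  | append_singleton l x _ =>
    rw [lifoRun_succ_append_singleton, List.mem_cons, List.mem_reverse] at h
    rcases h with rfl | h
    · simp
    · left
      rw [List.take_append]
      exact List.mem_append_left _ h

theorem not_mem_take_ofFn {V : Type*} {n k : ℕ} {f : Fin n → V} (hf : Function.Injective f)
    {a : Fin n} (ha : k ≤ a.val) : f a ∉ (List.ofFn f).take k := by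
  intro h
  obtain ⟨j, hj, hja⟩ := List.mem_iff_getElem.mp h
  rw [List.getElem_take, List.getElem_ofFn] at hja
  have hval := congrArg Fin.val (hf hja)
  simp only [List.length_take] at hj
  simp only at hval
  omega

/-- Converse direction of the reduction in Theorem 4.2: let `G` be a finite simple
graph on `n` vertices, `1 ≤ T ≤ n`, and `C = n - T + 1`.  If an enumeration
`e : Fin n ≃ V` of the vertices (each loaded exactly once), processed by an
initially empty LIFO cache of capacity `C`, covers every edge of `G`, then the
last `T` loaded vertices (those at 0-based positions `≥ n - T`) form an
independent set of size `T` in `G`. -/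
theorem lifo_cover_tail_indep {V : Type*} [Fintype V] [DecidableEq V]
    (G : SimpleGraph V) (n T : ℕ) (hn : n = Fintype.card V)
    (hT1 : 1 ≤ T) (hTn : T ≤ n) (e : Fin n ≃ V)
    (hcov : ∀ u w : V, G.Adj u w →
      coveredLIFO (n - T + 1) (List.ofFn fun j => e j) u w) :
    (Finset.image e (Finset.univ.filter fun j : Fin n => n - T ≤ j.val)).card = T ∧
    (∀ u ∈ Finset.image e (Finset.univ.filter fun j : Fin n => n - T ≤ j.val),
     ∀ w ∈ Finset.image e (Finset.univ.filter fun j : Fin n => n - T ≤ j.val),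
      ¬ G.Adj u w) := by
  refine ⟨?_, ?_⟩
  · rw [Finset.card_image_of_injective _ e.injective]
    have hcard := Fin.card_filter_val_lt (n := n) (m := n - T)
    have hsum := Finset.card_filter_add_card_filter_not
      (s := (Finset.univ : Finset (Fin n))) (fun j : Fin n => j.val < n - T)
    simp only [not_lt, Finset.card_univ, Fintype.card_fin] at hsum
    omega
  · intro u hu w hw hadj
    simp only [Finset.mem_image, Finset.mem_filter, Finset.mem_univ, true_and] at hu hw
    obtain ⟨a, ha, rfl⟩ := hu
    obtain ⟨b, hb, rfl⟩ := hw
    obtain ⟨i, -, hai, hbi⟩ := hcov _ _ hadj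
    have key : ∀ c : Fin n, n - T ≤ c.val →
        e c ∈ lifoRun (n - T + 1) ((List.ofFn fun j => e j).take i) →
        ((List.ofFn fun j => e j).take i).getLast? = some (e c) := by
      intro c hc h
      refine (mem_lifoRun_succ h).resolve_left fun hmem => not_mem_take_ofFn e.injective hc ?_
      rw [List.take_take, min_comm, ← List.take_take] at hmem
      exact List.mem_of_mem_take hmem
    have heq := (key a ha hai).symm.trans (key b hb hbi)
    exact hadj.ne (Option.some.inj heq)
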